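/- arXiv:2304.09678 — 2 statements merged into one kernel-verified Lean document; each statement's English description precedes it below -/
import Mathlib

section
/- Let X be an m×n real matrix, δ > 0, K = XᵀX, Z = K − δI, and for t ∈ (0,1)ⁿ let L_t = T Z T + δI. For z ∈ {−1,1}ⁿ define a(z) = K z, b(z) = L_t⁻¹(t ⊙ a(z)), and φ(z) = b(z) ⊙ Z(t ⊙ b(z)) − a(z) ⊙ b(z). Then the average of φ over all 2ⁿ sign vectors satisfies 2⁻ⁿ Σ_{z ∈ {−1,1}ⁿ} φ(z) = Diag[L_t⁻¹ T K² (T L_t⁻¹ T Z − I)]; consequently, with f_λ(t) = −tr(K T L_t⁻¹ T K) + λ Σⱼ tⱼ, the gradient satisfies ∇f_λ(t) = 2 E[φ(z)] + λ𝟙 where the expectation is over z uniform on {−1,1}ⁿ. -/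
open Matrix

/-- The vector of signs `±1` encoded by a Boolean vector. -/
def signVec {ι : Type*} (z : ι → Bool) : ι → ℝ := fun j => if z j then 1 else -1

section SignAverage

variable {ι : Type*} [Fintype ι] [DecidableEq ι]

/-- The coordinates of a uniformly random sign vector are orthonormal. -/
theorem sum_signVec_mul_signVec (i j : ι) :
    ∑ z : ι → Bool, signVec z i * signVec z j = if i = j then (2 : ℝ) ^ Fintype.card ι else 0 := by
  split_ifs with h
  · subst h
    have h1 : ∀ z : ι → Bool, signVec z i * signVec z i = 1 := by
      intro z
      unfold signVec
      split_ifs <;> norm_num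
    simp [h1]
  · have hinv : Function.Involutive
        (fun z : ι → Bool => Function.update z i (!z i)) := by
      intro z
      simp
    have hneg : ∀ z : ι → Bool,
        signVec (hinv.toPerm _ z) i * signVec (hinv.toPerm _ z) j = -(signVec z i * signVec z j) := by
      intro z
      have hj : j ≠ i := fun e => h e.symm
      simp only [Function.Involutive.coe_toPerm, signVec, Function.update_self,
        Function.update_of_ne hj]
      cases z i <;> cases z j <;> simp
    have hsum := Equiv.sum_comp (hinv.toPerm _)
      (fun z : ι → Bool => signVec z i * signVec z j)
    simp only [hneg, Finset.sum_neg_distrib] at hsum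
    linarith

/-- Averaging `(M z) ⊙ (N z)` over the sign vectors `z` gives the diagonal of `M Nᵀ`. -/
theorem average_mulVec_mul_mulVec (M N : Matrix ι ι ℝ) :
    ((2 : ℝ) ^ Fintype.card ι)⁻¹ • ∑ z : ι → Bool, (M *ᵥ signVec z) * (N *ᵥ signVec z) =
      Matrix.diag (M * Nᵀ) := by
  ext k
  have h : ∑ z : ι → Bool, (M *ᵥ signVec z) k * (N *ᵥ signVec z) k =
      ∑ i, ∑ j, M k i * N k j * ∑ z : ι → Bool, signVec z i * signVec z j := by
    simp only [Matrix.mulVec, dotProduct, Finset.sum_mul_sum]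
    rw [Finset.sum_comm]
    refine Finset.sum_congr rfl fun i _ => ?_
    simp only [Finset.mul_sum]
    rw [Finset.sum_comm]
    refine Finset.sum_congr rfl fun j _ => Finset.sum_congr rfl fun z _ => ?_
    ring
  simp only [Pi.smul_apply, Finset.sum_apply, Pi.mul_apply, smul_eq_mul, h,
    sum_signVec_mul_signVec, Matrix.diag_apply, Matrix.mul_apply, Matrix.transpose_apply]
  simp only [mul_ite, mul_zero, Finset.sum_ite_eq, Finset.mem_univ, if_true]
  rw [← Finset.sum_mul]
  field_simp

end SignAverage

/-- `T Xᵀ X T + δ (I - T²)` is positive definite for `T` diagonal with entries in `(0, 1)`. -/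
theorem posDef_diagonal_conj_add {m n : Type*} [Fintype m] [Fintype n] [DecidableEq n]
    (X : Matrix m n ℝ) {δ : ℝ} (hδ : 0 < δ) {t : n → ℝ} (ht : ∀ j, t j ∈ Set.Ioo (0 : ℝ) 1) :
    (diagonal t * (Xᵀ * X - δ • (1 : Matrix n n ℝ)) * diagonal t +
      δ • (1 : Matrix n n ℝ)).PosDef := by
  have hpsd : ((X * diagonal t)ᴴ * (X * diagonal t)).PosSemidef :=
    Matrix.posSemidef_conjTranspose_mul_self _
  have hpd : (diagonal fun j => δ * (1 - t j ^ 2) : Matrix n n ℝ).PosDef := by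
    refine Matrix.PosDef.diagonal fun j => ?_
    obtain ⟨h0, h1⟩ := ht j
    exact mul_pos hδ (by nlinarith)
  have heq : diagonal t * (Xᵀ * X - δ • (1 : Matrix n n ℝ)) * diagonal t + δ • (1 : Matrix n n ℝ) =
      (diagonal fun j => δ * (1 - t j ^ 2)) + (X * diagonal t)ᴴ * (X * diagonal t) := by
    have h1 : (diagonal fun j => δ * (1 - t j ^ 2) : Matrix n n ℝ) =
        δ • (1 : Matrix n n ℝ) - δ • (diagonal t * diagonal t) := by
      ext i j
      by_cases hij : i = j
      · subst hij
        simp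
        ring
      · simp [hij]
    rw [h1, conjTranspose_eq_transpose_of_trivial, transpose_mul, diagonal_transpose]
    simp only [mul_sub, sub_mul, Matrix.mul_smul, Matrix.smul_mul, Matrix.one_mul,
      Matrix.mul_assoc]
    abel
  rw [heq]
  exact hpd.add_posSemidef hpsd

section Derivative

attribute [local instance] Matrix.linftyOpNormedRing Matrix.linftyOpNormedAlgebra

variable {ι : Type*} [Fintype ι] [DecidableEq ι]

/-- Matrix inversion is differentiable at invertible matrices. -/
theorem hasDerivAt_matrix_inv {A : ℝ → Matrix ι ι ℝ} {A' : Matrix ι ι ℝ} {s : ℝ}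
    (hA : HasDerivAt A A' s) (hu : IsUnit (A s)) :
    HasDerivAt (fun x => (A x)⁻¹) (-((A s)⁻¹ * A' * (A s)⁻¹)) s := by
  obtain ⟨u, hu⟩ := hu
  have h := hasFDerivAt_ringInverse (𝕜 := ℝ) u
  rw [hu] at h
  have hinv : (fun x => (A x)⁻¹) = Ring.inverse ∘ A :=
    funext fun x => Matrix.nonsing_inv_eq_ringInverse (A x)
  rw [hinv]
  refine (h.comp_hasDerivAt s hA).congr_deriv ?_
  simp [← hu]

theorem differentiable_diagonal :
    Differentiable ℝ (diagonal : (ι → ℝ) → Matrix ι ι ℝ) :=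
  (LinearMap.toContinuousLinearMap (Matrix.diagonalLinearMap ι ℝ ℝ)).differentiable

/-- `t ↦ tr (K T (T Z T + δ I)⁻¹ T K)` is differentiable where `T Z T + δ I` is invertible. -/
theorem differentiableAt_trace_diagonal_inv (K Z : Matrix ι ι ℝ) (δ : ℝ) (t : ι → ℝ)
    (hu : IsUnit (diagonal t * Z * diagonal t + δ • (1 : Matrix ι ι ℝ))) :
    DifferentiableAt ℝ (fun t : ι → ℝ =>
      (K * diagonal t * (diagonal t * Z * diagonal t + δ • (1 : Matrix ι ι ℝ))⁻¹ *
        diagonal t * K).trace) t := by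
  have hD := (differentiable_diagonal (ι := ι)) t
  have hL : DifferentiableAt ℝ
      (fun t : ι → ℝ => diagonal t * Z * diagonal t + δ • (1 : Matrix ι ι ℝ)) t :=
    ((hD.mul_const Z).mul hD).add_const _
  have hI : DifferentiableAt ℝ
      (fun t : ι → ℝ => (diagonal t * Z * diagonal t + δ • (1 : Matrix ι ι ℝ))⁻¹) t := by
    simp only [Matrix.nonsing_inv_eq_ringInverse]
    obtain ⟨u, hu⟩ := hu
    have h := (hasFDerivAt_ringInverse (𝕜 := ℝ) u).differentiableAt
    rw [hu] at h
    exact h.comp t hL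
  exact ((LinearMap.toContinuousLinearMap
    (Matrix.traceLinearMap ι ℝ ℝ)).differentiableAt).comp t ((((hD.const_mul K).mul hI).mul hD).mul_const K)

/-- The derivative of `tr (K T (T Z T + δ I)⁻¹ T K)` along a line in the `T` variable. -/
theorem hasDerivAt_trace_diagonal_inv (K Z : Matrix ι ι ℝ) (δ : ℝ) (t v : ι → ℝ)
    (L : Matrix ι ι ℝ) (hL : L = diagonal t * Z * diagonal t + δ • (1 : Matrix ι ι ℝ))
    (hu : IsUnit L) :
    HasDerivAt (fun s : ℝ =>
      (K * diagonal (t + s • v) * (diagonal (t + s • v) * Z * diagonal (t + s • v) +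
        δ • (1 : Matrix ι ι ℝ))⁻¹ * diagonal (t + s • v) * K).trace)
      (((K * diagonal v * L⁻¹ + K * diagonal t *
        -(L⁻¹ * (diagonal v * Z * diagonal t + diagonal t * Z * diagonal v) * L⁻¹)) * diagonal t * K
        + K * diagonal t * L⁻¹ * diagonal v * K).trace) 0 := by
  have hD : HasDerivAt (fun s : ℝ => (diagonal (t + s • v) : Matrix ι ι ℝ)) (diagonal v) 0 := by
    have h1 : HasDerivAt (fun s : ℝ => t + s • v) v 0 := by
      simpa using ((hasDerivAt_id (0 : ℝ)).smul_const v).const_add t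
    exact (LinearMap.toContinuousLinearMap
      (Matrix.diagonalLinearMap ι ℝ ℝ)).hasFDerivAt.comp_hasDerivAt 0 h1
  have hLd := ((hD.mul_const Z).mul hD).add_const (δ • (1 : Matrix ι ι ℝ))
  have hI := hasDerivAt_matrix_inv hLd (by simpa [← hL] using hu)
  have hM := (((hD.const_mul K).mul hI).mul hD).mul_const K
  have hT := (LinearMap.toContinuousLinearMap
      (Matrix.traceLinearMap ι ℝ ℝ)).hasFDerivAt.comp_hasDerivAt 0 hM
  refine hT.congr_deriv ?_
  simp only [Pi.mul_apply, zero_smul, add_zero, ← hL, add_mul]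
  rfl

end Derivative

theorem trace_mul_diagonal_single {ι : Type*} [Fintype ι] [DecidableEq ι] (A B : Matrix ι ι ℝ)
    (j : ι) : (A * diagonal (Pi.single j 1) * B).trace = (B * A) j j := by
  rw [Matrix.trace_mul_comm, ← Matrix.mul_assoc, Matrix.trace]
  simp [Matrix.mul_diagonal, Pi.single_apply]

/-- With `K = XᵀX`, `Z = K − δI`, `L_t = T Z T + δI`, and for a
sign vector `z ∈ {−1,1}ⁿ` the quantities `a(z) = Kz`, `b(z) = L_t⁻¹(t ⊙ a(z))`,
`φ(z) = b(z) ⊙ Z(t ⊙ b(z)) − a(z) ⊙ b(z)`, the average of `φ` over all `2ⁿ`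
sign vectors equals `Diag[L_t⁻¹ T K² (T L_t⁻¹ T Z − I)]`; consequently with
`f_λ(t) = −tr(K T L_t⁻¹ T K) + λ Σⱼ tⱼ` we get `∇f_λ(t) = 2 E[φ(z)] + λ𝟙`. -/
theorem stmt_7 {m n : ℕ} (X : Matrix (Fin m) (Fin n) ℝ)
    (δ : ℝ) (hδ : 0 < δ) (lam : ℝ)
    (K Z : Matrix (Fin n) (Fin n) ℝ)
    (hK : K = Xᵀ * X) (hZ : Z = K - δ • 1)
    (L : (Fin n → ℝ) → Matrix (Fin n) (Fin n) ℝ)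
    (hL : ∀ t, L t = Matrix.diagonal t * Z * Matrix.diagonal t + δ • 1)
    (t : Fin n → ℝ) (ht : ∀ j, t j ∈ Set.Ioo (0 : ℝ) 1)
    (a b φ : (Fin n → ℝ) → (Fin n → ℝ))
    (ha : ∀ z, a z = K *ᵥ z)
    (hb : ∀ z, b z = (L t)⁻¹ *ᵥ (t * a z))
    (hφ : ∀ z, φ z = b z * (Z *ᵥ (t * b z)) - a z * b z)
    (f : (Fin n → ℝ) → ℝ)
    (hf : ∀ t', f t' =
      -(K * Matrix.diagonal t' * (L t')⁻¹ * Matrix.diagonal t' * K).trace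
        + lam * ∑ j, t' j) :
    ((2 : ℝ) ^ n)⁻¹ •
        (∑ z : Fin n → Bool, φ (fun j => if z j then 1 else -1)) =
      Matrix.diag ((L t)⁻¹ * Matrix.diagonal t * K ^ 2 *
          (Matrix.diagonal t * (L t)⁻¹ * Matrix.diagonal t * Z - 1)) ∧
    DifferentiableAt ℝ f t ∧
      ∀ j, fderiv ℝ f t (Pi.single j 1) =
        2 * (((2 : ℝ) ^ n)⁻¹ •
              (∑ z : Fin n → Bool, φ (fun j' => if z j' then 1 else -1))) j
          + lam := by
  have hKs : Kᵀ = K := by rw [hK]; simp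
  have hZs : Zᵀ = Z := by rw [hZ]; simp [hKs]
  have hpd : (L t).PosDef := by
    rw [hL, hZ, hK]
    exact posDef_diagonal_conj_add X hδ ht
  have hu : IsUnit (L t) := hpd.isUnit
  have hLs : (L t)ᵀ = L t := by
    rw [hL]; simp [hZs, Matrix.mul_assoc]
  have hLis : ((L t)⁻¹)ᵀ = (L t)⁻¹ := by rw [transpose_nonsing_inv, hLs]
  have havg : ((2 : ℝ) ^ n)⁻¹ •
        (∑ z : Fin n → Bool, φ (fun j => if z j then 1 else -1)) =
      Matrix.diag ((L t)⁻¹ * Matrix.diagonal t * K ^ 2 *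
          (Matrix.diagonal t * (L t)⁻¹ * Matrix.diagonal t * Z - 1)) := by
    have hdiag : ∀ w : Fin n → ℝ, t * w = diagonal t *ᵥ w := fun w => by
      ext i
      simp [mulVec_diagonal]
    have h1 : ∀ z : Fin n → Bool, φ (fun j => if z j then 1 else -1) =
        (((L t)⁻¹ * diagonal t * K) *ᵥ signVec z) *
          ((Z * diagonal t * (L t)⁻¹ * diagonal t * K - K) *ᵥ signVec z) := by
      intro z
      change φ (signVec z) = _
      rw [hφ, hb, ha, sub_mulVec, mul_sub, mul_comm (K *ᵥ signVec z)]
      simp only [hdiag, mulVec_mulVec, Matrix.mul_assoc]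
    have h2 := average_mulVec_mul_mulVec ((L t)⁻¹ * diagonal t * K)
      (Z * diagonal t * (L t)⁻¹ * diagonal t * K - K)
    rw [Fintype.card_fin] at h2
    simp only [h1, h2]
    congr 1
    simp only [transpose_sub, transpose_mul, hKs, hZs, hLis, diagonal_transpose, pow_two, mul_sub,
      Matrix.mul_assoc, Matrix.mul_one]
  have hfeq : f = fun t' => -(K * diagonal t' * (diagonal t' * Z * diagonal t' +
      δ • (1 : Matrix (Fin n) (Fin n) ℝ))⁻¹ * diagonal t' * K).trace + lam * ∑ j, t' j := by
    funext t'
    rw [hf, hL]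
  have hdiff : DifferentiableAt ℝ f t := by
    rw [hfeq]
    refine (differentiableAt_trace_diagonal_inv K Z δ t (hL t ▸ hu)).neg.add ?_
    fun_prop
  refine ⟨havg, hdiff, fun j => ?_⟩
  rw [havg, ← hdiff.lineDeriv_eq_fderiv]
  have hlin : HasDerivAt (fun s : ℝ => lam * ∑ i, (t + s • (Pi.single j 1 : Fin n → ℝ)) i) lam 0 := by
    have h : (fun s : ℝ => lam * ∑ i, (t + s • (Pi.single j 1 : Fin n → ℝ)) i) =
        fun s => lam * (∑ i, t i + s) := by
      funext s
      simp [Finset.sum_add_distrib, ← Finset.mul_sum]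
    rw [h]
    simpa using ((hasDerivAt_id (0 : ℝ)).const_add (∑ i, t i)).const_mul lam
  have hder := (hasDerivAt_trace_diagonal_inv K Z δ t (Pi.single j 1) (L t) (hL t) hu).neg.add hlin
  rw [lineDeriv, hfeq]
  refine hder.deriv.trans ?_
  set T := diagonal t with hT
  set R := (L t)⁻¹ with hR
  set E : Matrix (Fin n) (Fin n) ℝ := diagonal (Pi.single j 1) with hE
  have hTs : Tᵀ = T := diagonal_transpose t
  have e1 : (K * E * (R * T * K)).trace = (R * T * K ^ 2) j j := by
    rw [trace_mul_diagonal_single, pow_two, ← Matrix.mul_assoc]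
  have e2 : (K * T * R * E * K).trace = (R * T * K ^ 2) j j := by
    rw [trace_mul_diagonal_single, ← transpose_apply (_ * _) j j]
    simp only [transpose_mul, hKs, hTs, hLis, pow_two, Matrix.mul_assoc]
  have e3 : (K * T * R * E * (Z * T * R * T * K)).trace = (R * T * K ^ 2 * (T * R * T * Z)) j j := by
    rw [trace_mul_diagonal_single, ← transpose_apply (_ * _) j j]
    simp only [transpose_mul, hKs, hTs, hLis, hZs, pow_two, Matrix.mul_assoc]
  have e4 : (K * T * R * T * Z * E * (R * T * K)).trace =
      (R * T * K ^ 2 * (T * R * T * Z)) j j := by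
    rw [trace_mul_diagonal_single]
    simp only [pow_two, Matrix.mul_assoc]
  simp only [Matrix.mul_assoc] at e1 e2 e3 e4
  simp only [diag_apply, mul_sub, add_mul, mul_add, mul_neg, neg_mul, trace_add, trace_neg,
    Matrix.mul_one, Matrix.sub_apply, Matrix.mul_assoc, e1, e2, e3, e4]
  ring
end

section
/- Let K be an n×n real symmetric positive semidefinite matrix, δ > 0, Z = K − δI, and for t ∈ (0,1)ⁿ let L_t = T Z T + δI, K̃(t) = K T L_t⁻¹ T K, and D = K̃(t) − K. For z ∈ {−1,1}ⁿ define a(z) = K z, b(z) = L_t⁻¹(t ⊙ a(z)), c(z) = K(t ⊙ b(z)) − a(z), d(z) = K c(z), e(z) = L_t⁻¹(t ⊙ d(z)), and ψ(z) = b(z) ⊙ d(z) + a(z) ⊙ e(z) − e(z) ⊙ Z(t ⊙ b(z)) − b(z) ⊙ Z(t ⊙ e(z)). Then 2⁻ⁿ Σ_{z ∈ {−1,1}ⁿ} ψ(z) = 2 Diag[L_t⁻¹ T K D K (I − T L_t⁻¹ T Z)]; consequently, with g_λ(t) = ‖K − K̃(t)‖_F² + λ Σⱼ tⱼ, the gradient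 satisfies ∇g_λ(t) = 2 E[ψ(z)] + λ𝟙 where the expectation is over z uniform on {−1,1}ⁿ. -/
open Matrix

theorem sum_sign_mul_sign {n : ℕ} (k l : Fin n) :
    ∑ z : Fin n → Bool, (if z k then (1 : ℝ) else -1) * (if z l then 1 else -1) =
      if k = l then 2 ^ n else 0 := by
  split_ifs with h
  · subst h
    have (z : Fin n → Bool) : (if z k then (1 : ℝ) else -1) * (if z k then 1 else -1) = 1 := by
      split_ifs <;> norm_num
    simp [this]
  · refine Finset.sum_involution (fun z _ => Function.update z k (!z k)) ?_ ?_ ?_ ?_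
    · intro z _
      rw [Function.update_self, Function.update_of_ne (Ne.symm h)]
      cases z k <;> cases z l <;> simp
    · intro z _ _ hz
      simpa using congrFun hz k
    · simp
    · intro z _
      simp

/-- Hutchinson's identity: the average of `(A z) ⊙ (B z)` over sign vectors is `Diag[A Bᵀ]`. -/
theorem sum_sign_mulVec_mul_mulVec {n : ℕ} (A B : Matrix (Fin n) (Fin n) ℝ) (i : Fin n) :
    ∑ z : Fin n → Bool, (A *ᵥ (fun j => if z j then 1 else -1)) i *
      (B *ᵥ (fun j => if z j then 1 else -1)) i = 2 ^ n * (A * Bᵀ) i i := by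
  simp only [mulVec, dotProduct, Finset.sum_mul_sum]
  rw [Finset.sum_comm, mul_apply, Finset.mul_sum]
  refine Finset.sum_congr rfl fun k _ => ?_
  rw [Finset.sum_comm]
  have (l : Fin n) : ∑ z : Fin n → Bool, A i k * (if z k then 1 else -1) *
      (B i l * (if z l then 1 else -1)) = A i k * B i l * if k = l then 2 ^ n else 0 := by
    rw [← sum_sign_mul_sign, Finset.mul_sum]
    exact Finset.sum_congr rfl fun z _ => by ring
  rw [Finset.sum_congr rfl fun l _ => this l]
  simp [mul_comm]

theorem posDef_diagonal_mul_mul_diagonal_add {n : ℕ} {K : Matrix (Fin n) (Fin n) ℝ}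
    (hK : K.PosSemidef) {δ : ℝ} (hδ : 0 < δ) {t : Fin n → ℝ}
    (ht : ∀ j, t j ∈ Set.Ioo (0 : ℝ) 1) :
    (diagonal t * (K - δ • 1) * diagonal t + δ • 1).PosDef := by
  have h1 : diagonal t * (K - δ • 1) * diagonal t + δ • 1 =
      diagonal (fun j => δ * (1 - t j ^ 2)) + diagonal t * K * diagonal t := by
    ext i j
    by_cases h : i = j
    · subst h; simp; ring
    · simp [h]
  rw [h1]
  refine PosDef.add_posSemidef (.diagonal fun j => ?_) ?_
  · have := ht j
    have : t j ^ 2 < 1 := by nlinarith [this.1, this.2]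
    exact mul_pos hδ (by linarith)
  · simpa using hK.mul_mul_conjTranspose_same (diagonal t)

open scoped Matrix.Norms.Operator in
/-- The derivative of `t ↦ K T L⁻¹ T K`, where `L = T Z T + δ I` and `T = Diag(t)`. -/
theorem exists_hasFDerivAt_mul_diagonal_mul_inv {n : ℕ} (K Z : Matrix (Fin n) (Fin n) ℝ) (δ : ℝ)
    (t : Fin n → ℝ) (hL : IsUnit (diagonal t * Z * diagonal t + δ • 1)) :
    ∃ f' : (Fin n → ℝ) →L[ℝ] Matrix (Fin n) (Fin n) ℝ,
      (∀ i j, HasFDerivAt (fun s => (K * diagonal s *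
        (diagonal s * Z * diagonal s + δ • 1)⁻¹ * diagonal s * K) i j)
        ((entryLinearMap ℝ ℝ i j).toContinuousLinearMap ∘L f') t) ∧
      ∀ v, f' v = K * diagonal v * (diagonal t * Z * diagonal t + δ • 1)⁻¹ * diagonal t * K
        + K * diagonal t * (diagonal t * Z * diagonal t + δ • 1)⁻¹ * diagonal v * K
        - K * diagonal t * (diagonal t * Z * diagonal t + δ • 1)⁻¹ *
          (diagonal v * Z * diagonal t + diagonal t * Z * diagonal v) *
          (diagonal t * Z * diagonal t + δ • 1)⁻¹ * diagonal t * K := by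
  obtain ⟨u, hu⟩ := hL
  have hT : HasFDerivAt (fun s : Fin n → ℝ => diagonal s)
      (diagonalLinearMap (Fin n) ℝ ℝ).toContinuousLinearMap t :=
    (diagonalLinearMap (Fin n) ℝ ℝ).toContinuousLinearMap.hasFDerivAt
  have hL' := ((hT.mul_const' Z).mul' hT).add_const (δ • (1 : Matrix (Fin n) (Fin n) ℝ))
  have hinv := (hasFDerivAt_ringInverse (𝕜 := ℝ) u)
  rw [hu] at hinv
  have hI := hinv.comp t hL'
  have hF := ((((hT.const_mul K).mul' hI).mul' hT).mul_const' K)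
  have hu' : (diagonal t * Z * diagonal t + δ • 1)⁻¹ = ↑u⁻¹ := by rw [← hu, coe_units_inv]
  replace hF := hF.congr_of_eventuallyEq (f₁ := fun s => K * diagonal s *
    (diagonal s * Z * diagonal s + δ • 1)⁻¹ * diagonal s * K)
    (.of_forall fun s => by simp [nonsing_inv_eq_ringInverse])
  refine ⟨_, fun i j => (entryLinearMap ℝ ℝ i j).toContinuousLinearMap.hasFDerivAt.comp t hF,
    fun v => ?_⟩
  change (K * diagonal t * Ring.inverse (diagonal t * Z * diagonal t + δ • 1) * diagonal v +
    (K * diagonal t * -((↑u⁻¹ : Matrix (Fin n) (Fin n) ℝ) *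
      (diagonal t * Z * diagonal v + diagonal v * Z * diagonal t) *
        (↑u⁻¹ : Matrix (Fin n) (Fin n) ℝ)) +
      K * diagonal v * Ring.inverse (diagonal t * Z * diagonal t + δ • 1)) * diagonal t) * K = _
  rw [← nonsing_inv_eq_ringInverse, hu']
  noncomm_ring

theorem trace_mul_diagonal_single_mul {n : ℕ} (A B : Matrix (Fin n) (Fin n) ℝ) (j : Fin n) :
    (A * diagonal (Pi.single j 1) * B).trace = (B * A) j j := by
  rw [trace_mul_comm, ← mul_assoc, diagonal_single, trace_mul_single]
  simp

/-- With `K` symmetric PSD, `Z = K − δI`, `L_t = T Z T + δI`,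
`K̃(t) = K T L_t⁻¹ T K`, `D = K̃(t) − K`, and for a sign vector `z ∈ {−1,1}ⁿ`
the quantities `a(z) = Kz`, `b(z) = L_t⁻¹(t ⊙ a(z))`, `c(z) = K(t ⊙ b(z)) − a(z)`,
`d(z) = K c(z)`, `e(z) = L_t⁻¹(t ⊙ d(z))`,
`ψ(z) = b(z) ⊙ d(z) + a(z) ⊙ e(z) − e(z) ⊙ Z(t ⊙ b(z)) − b(z) ⊙ Z(t ⊙ e(z))`,
the average of `ψ` over all `2ⁿ` sign vectors equals
`2 Diag[L_t⁻¹ T K D K (I − T L_t⁻¹ T Z)]`; consequently with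
`g_λ(t) = ‖K − K̃(t)‖_F² + λ Σⱼ tⱼ` we get `∇g_λ(t) = 2 E[ψ(z)] + λ𝟙`. -/
theorem stmt_8 {n : ℕ} (K : Matrix (Fin n) (Fin n) ℝ) (hK : K.PosSemidef)
    (δ : ℝ) (hδ : 0 < δ) (lam : ℝ)
    (Z : Matrix (Fin n) (Fin n) ℝ) (hZ : Z = K - δ • 1)
    (L : (Fin n → ℝ) → Matrix (Fin n) (Fin n) ℝ)
    (hL : ∀ t, L t = Matrix.diagonal t * Z * Matrix.diagonal t + δ • 1)
    (Kt : (Fin n → ℝ) → Matrix (Fin n) (Fin n) ℝ)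
    (hKt : ∀ t, Kt t = K * Matrix.diagonal t * (L t)⁻¹ * Matrix.diagonal t * K)
    (t : Fin n → ℝ) (ht : ∀ j, t j ∈ Set.Ioo (0 : ℝ) 1)
    (a b c d e ψ : (Fin n → ℝ) → (Fin n → ℝ))
    (ha : ∀ z, a z = K *ᵥ z)
    (hb : ∀ z, b z = (L t)⁻¹ *ᵥ (t * a z))
    (hc : ∀ z, c z = K *ᵥ (t * b z) - a z)
    (hd : ∀ z, d z = K *ᵥ c z)
    (he : ∀ z, e z = (L t)⁻¹ *ᵥ (t * d z))
    (hψ : ∀ z, ψ z = b z * d z + a z * e z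
        - e z * (Z *ᵥ (t * b z)) - b z * (Z *ᵥ (t * e z)))
    (g : (Fin n → ℝ) → ℝ)
    (hg : ∀ t', g t' = (∑ i, ∑ j, ((K - Kt t') i j) ^ 2) + lam * ∑ j, t' j) :
    ((2 : ℝ) ^ n)⁻¹ •
        (∑ z : Fin n → Bool, ψ (fun j => if z j then 1 else -1)) =
      (fun j => 2 * Matrix.diag ((L t)⁻¹ * Matrix.diagonal t * K * (Kt t - K) * K *
          (1 - Matrix.diagonal t * (L t)⁻¹ * Matrix.diagonal t * Z)) j) ∧
    DifferentiableAt ℝ g t ∧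
      ∀ j, fderiv ℝ g t (Pi.single j 1) =
        2 * (((2 : ℝ) ^ n)⁻¹ •
              (∑ z : Fin n → Bool, ψ (fun j' => if z j' then 1 else -1))) j
          + lam := by
  have hK' : Kᵀ = K := by simpa using hK.isHermitian.eq
  have hZ' : Zᵀ = Z := by simp [hZ, hK']
  have hL' : (L t)ᵀ = L t := by simp [hL, hZ', mul_assoc]
  set W := (L t)⁻¹ with hW
  have hW' : Wᵀ = W := by rw [hW, transpose_nonsing_inv, hL']
  have hKt' : (Kt t)ᵀ = Kt t := by simp [hKt, ← hW, hW', hK', mul_assoc]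
  have hmul (v : Fin n → ℝ) : t * v = diagonal t *ᵥ v := by ext; simp [mulVec_diagonal]
  set D := Kt t - K with hD
  have hD' : Dᵀ = D := by simp [hD, hKt', hK']
  set T := diagonal t with hT
  have hT' : Tᵀ = T := diagonal_transpose t
  have hbz (z) : b z = (W * T * K) *ᵥ z := by simp [hb, ha, hmul, mul_assoc]
  have hcz (z) : c z = D *ᵥ z := by
    simp [hc, ha, hbz, hmul, hD, hKt, sub_mulVec, mul_assoc, ← hT, ← hW]
  have hdz (z) : d z = (K * D) *ᵥ z := by simp [hd, hcz]
  have hez (z) : e z = (W * T * K * D) *ᵥ z := by simp [he, hdz, hmul, mul_assoc]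
  have hmean : ((2 : ℝ) ^ n)⁻¹ • (∑ z : Fin n → Bool, ψ (fun j => if z j then 1 else -1)) =
      fun j => 2 * diag (W * T * K * D * K * (1 - T * W * T * Z)) j := by
    ext i
    have h2 : (2 : ℝ) ^ n ≠ 0 := by positivity
    have hψz (z) : ψ z i = ((W * T * K) *ᵥ z) i * ((K * D) *ᵥ z) i +
        ((W * T * K * D) *ᵥ z) i * (K *ᵥ z) i
        - ((W * T * K * D) *ᵥ z) i * ((Z * T * W * T * K) *ᵥ z) i
        - ((W * T * K) *ᵥ z) i * ((Z * T * W * T * K * D) *ᵥ z) i := by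
      simp [hψ, ha, hbz, hdz, hez, hmul, mul_assoc, mul_comm]
    simp only [Pi.smul_apply, Finset.sum_apply, hψz, Finset.sum_sub_distrib,
      Finset.sum_add_distrib, sum_sign_mulVec_mul_mulVec, smul_eq_mul]
    simp only [transpose_mul, hK', hD', hT', hW', hZ', mul_assoc, mul_sub, mul_one, diag_apply,
      Matrix.sub_apply]
    field_simp
    ring
  have hunit : IsUnit (T * Z * T + δ • 1) := by
    rw [hZ]
    exact (posDef_diagonal_mul_mul_diagonal_add hK hδ ht).isUnit
  obtain ⟨f', hf', hf'v⟩ := exists_hasFDerivAt_mul_diagonal_mul_inv K Z δ t hunit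
  have hentry (i j) : HasFDerivAt (fun s => Kt s i j)
      ((entryLinearMap ℝ ℝ i j).toContinuousLinearMap ∘L f') t := by
    simpa only [hKt, hL] using hf' i j
  have hgd := (HasFDerivAt.fun_sum (u := Finset.univ) fun i _ =>
    HasFDerivAt.fun_sum (u := Finset.univ) fun j _ => ((hentry i j).const_sub (K i j)).pow 2).add
    ((HasFDerivAt.fun_sum (u := Finset.univ) fun j _ =>
      (ContinuousLinearMap.proj (R := ℝ) (φ := fun _ : Fin n => ℝ) j).hasFDerivAt
        (x := t)).const_mul lam)
  replace hgd := hgd.congr_of_eventuallyEq (f₁ := g) (.of_forall fun s => by simp [hg])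
  refine ⟨hmean, hgd.differentiableAt, fun j => ?_⟩
  rw [hgd.fderiv, hmean]
  have htrace : ∑ i, ∑ k, D i k * f' (Pi.single j 1) i k =
      2 * (W * T * K * D * K * (1 - T * W * T * Z)) j j := by
    rw [show ∑ i, ∑ k, D i k * f' (Pi.single j 1) i k = (f' (Pi.single j 1) * D).trace by
      rw [← trace_transpose, transpose_mul, hD']; rfl]
    set E : Matrix (Fin n) (Fin n) ℝ := diagonal (Pi.single j 1) with hE
    have h1 := trace_mul_diagonal_single_mul K (W * T * K * D) j
    have h2 := trace_mul_diagonal_single_mul (K * T * W) (K * D) j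
    have h3 := trace_mul_diagonal_single_mul (K * T * W) (Z * T * W * T * K * D) j
    have h4 := trace_mul_diagonal_single_mul (K * T * W * T * Z) (W * T * K * D) j
    rw [← transpose_apply (_ * _) j j] at h2 h3
    rw [hf'v, ← hL, ← hW, ← hE, ← hT]
    simp only [← hE, transpose_mul, hK', hD', hT', hW', hZ', mul_assoc] at h1 h2 h3 h4
    simp only [add_mul, sub_mul, mul_add, mul_sub, mul_one, trace_add, trace_sub, mul_assoc,
      h1, h2, h3, h4, Matrix.sub_apply]
    ring
  have hneg (i k) : K i k - Kt t i k = -D i k := by simp [hD]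
  have hlam : ∑ k, (Pi.single j (1 : ℝ) : Fin n → ℝ) k = 1 := by simp
  simp [hneg, hlam, ← htrace, Finset.mul_sum, mul_assoc (2 : ℝ)]
end
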